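/- Let X be a geodesic δ-hyperbolic metric space, let G be a group that is not virtually cyclic acting on X by isometries with a unital axial WPD loxodromic element f ∈ G, let x₀ ∈ Ax(f), and let S be a finite generating set of G. Then there exists D₀ > 0 such that for each D ≥ D₀ (with 200D an integer) and each E > 0 there exists R > 0 with the following property: if u, v ∈ G and there exists w ∈ u·𝔄_{D,E,f}(u⁻¹) ∩ v·𝔅_{D,E,f}(v⁻¹), then at least one of the following holds: (1) v ∈ u·𝔄_{D,E,f}(u⁻¹) and d(wx₀, vx₀) < d(wx₀, ux₀); (2) u ∈ v·𝔅_{D,E,f}(v⁻¹) and d(wx₀, ux₀) < d(wx₀, vx₀); (3) d_S(u,v) ≤ R. -/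

import Mathlib

noncomputable section

open Set Metric Pointwise

/-- The Gromov product `(y|z)_x`. -/
def gromovProd {X : Type*} [MetricSpace X] (x y z : X) : ℝ :=
  (dist x y + dist x z - dist y z) / 2

/-- `γ` restricted to `[a, b]` is a unit-speed geodesic. -/
def IsGeodesicParam {X : Type*} [MetricSpace X] (γ : ℝ → X) (a b : ℝ) : Prop :=
  ∀ s ∈ Set.Icc a b, ∀ t ∈ Set.Icc a b, dist (γ s) (γ t) = |s - t|

/-- `γ` is a geodesic from `x` to `y`, parametrized by arclength on `[0, dist x y]`. -/
def IsGeodesicBetween {X : Type*} [MetricSpace X] (γ : ℝ → X) (x y : X) : Prop :=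
  γ 0 = x ∧ γ (dist x y) = y ∧ IsGeodesicParam γ 0 (dist x y)

/-- A geodesic metric space: any two points are joined by a geodesic. -/
def GeodesicSpace (X : Type*) [MetricSpace X] : Prop :=
  ∀ x y : X, ∃ γ : ℝ → X, IsGeodesicBetween γ x y

/-- A geodesic space in which every geodesic triangle is `δ`-thin. -/
def GromovHyperbolic (X : Type*) [MetricSpace X] (δ : ℝ) : Prop :=
  GeodesicSpace X ∧
    ∀ (x y z : X) (γ₁ γ₂ γ₃ : ℝ → X),
      IsGeodesicBetween γ₁ x z → IsGeodesicBetween γ₂ x y → IsGeodesicBetween γ₃ y z →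
        ∀ t ∈ Set.Icc (0 : ℝ) (dist x z),
          ∃ u ∈ γ₂ '' Set.Icc (0 : ℝ) (dist x y) ∪ γ₃ '' Set.Icc (0 : ℝ) (dist y z),
            dist (γ₁ t) u ≤ δ

/-- A subset of `X` which is the image of a geodesic segment. -/
def IsGeodesicSegSet {X : Type*} [MetricSpace X] (A : Set X) : Prop :=
  ∃ (γ : ℝ → X) (a b : ℝ), a ≤ b ∧ IsGeodesicParam γ a b ∧ A = γ '' Set.Icc a b

/-- The set of nearest-point projections of `x` to `A`. -/
def nearestPts {X : Type*} [MetricSpace X] (A : Set X) (x : X) : Set X :=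
  {a ∈ A | dist x a = Metric.infDist x A}

/-- The nearest-point projection of the set `B` to `A`. -/
def projSet {X : Type*} [MetricSpace X] (A B : Set X) : Set X := ⋃ x ∈ B, nearestPts A x

/-- `diam_A(B)`, the diameter of the projection of `B` to `A`. -/
def projDiam {X : Type*} [MetricSpace X] (A B : Set X) : ℝ := Metric.diam (projSet A B)

/-- `d_A(B, C) = diam (π_A (B ∪ C))`. -/
def projDist {X : Type*} [MetricSpace X] (A B C : Set X) : ℝ := Metric.diam (projSet A (B ∪ C))

/-- The halfspace `H_half(x, y)` of points at least as close to `x` as to `y`. -/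
def halfspace {X : Type*} [MetricSpace X] (x y : X) : Set X := {z | dist z x ≤ dist z y}

/-- A group is virtually cyclic if it has a cyclic subgroup of finite index. -/
def VirtuallyCyclic (G : Type*) [Group G] : Prop :=
  ∃ H : Subgroup G, H.FiniteIndex ∧ IsCyclic H

/-- The WPD property for `f` relative to the basepoint `x₀`. -/
def WPD {G : Type*} [Group G] {X : Type*} [MetricSpace X] [MulAction G X]
    (f : G) (x₀ : X) : Prop :=
  ∀ R : ℝ, 0 < R → ∃ L : ℕ, 0 < L ∧
    {g : G | dist x₀ (g • x₀) < R ∧ dist ((f ^ L) • x₀) ((g * f ^ L) • x₀) < R}.Finite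

/-- The word norm with respect to the generating set `S`. -/
def wordNorm {G : Type*} [Group G] (S : Finset G) (g : G) : ℕ :=
  sInf {n : ℕ | ∃ l : List G, l.length = n ∧ (∀ x ∈ l, x ∈ S ∨ x⁻¹ ∈ S) ∧ l.prod = g}

/-- The word metric with respect to the generating set `S`. -/
def wordDist {G : Type*} [Group G] (S : Finset G) (g h : G) : ℕ := wordNorm S (g⁻¹ * h)

/-- `B` is an `r`-roughly branching subset of `G`. -/
def RoughlyBranching {G : Type*} [Group G] (S : Finset G) (r : ℝ) (B : Set G) : Prop :=
  ∃ B' : Set G,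
    (∀ b ∈ B, ∃ b' ∈ B', (wordDist S b b' : ℝ) ≤ r) ∧
    ∀ k : ℕ, 1 ≤ k → ∀ g h : Fin k → G, (∀ i, g i ∈ B') → (∀ i, h i ∈ B') →
      (List.ofFn g).prod = (List.ofFn h).prod → g = h

/-- Auxiliary anti-halfspace with sign/exponent `m`, word-norm bound `Eb` and first
closeness parameter `r₁`. -/
def antiHalfSgn {X : Type*} [MetricSpace X] {G : Type*} [Group G] [MulAction G X]
    (S : Finset G) (f : G) (x₀ : X) (δ D Eb r₁ : ℝ) (m : ℤ) (g : G) : Set G :=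
  {u : G | ∃ (γ : ℝ → X) (τ τ₁ τ₂ τ₃ : ℝ) (h : G),
    0 ≤ τ₁ ∧ τ₁ ≤ τ₂ ∧ τ₂ ≤ τ₃ ∧ τ₃ ≤ τ ∧
    IsGeodesicParam γ 0 τ ∧ γ 0 = g • x₀ ∧ (wordNorm S h : ℝ) ≤ Eb ∧
    dist (γ τ₁) x₀ < r₁ ∧ dist (γ τ₂) (h • x₀) < 20 * δ ∧
    dist (γ τ₃) ((h * f ^ m) • x₀) < 20 * δ ∧ dist (γ τ) (u • x₀) < 5 * D}

/-- The anti-halfspace `𝔄_{D,E,f}(g) = 𝔄⁺_{D,E,f}(g) ∪ 𝔄⁻_{D,E,f}(g)`. -/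
def antiHalfA {X : Type*} [MetricSpace X] {G : Type*} [Group G] [MulAction G X]
    (S : Finset G) (f : G) (x₀ : X) (δ D E : ℝ) (g : G) : Set G :=
  antiHalfSgn S f x₀ δ D E (1.1 * D) ⌊200 * D⌋ g ∪
    antiHalfSgn S f x₀ δ D E (1.1 * D) (-⌊200 * D⌋) g

/-- The anti-halfspace `𝔅_{D,E,f}(g) = 𝔅⁺_{D,E,f}(g) ∪ 𝔅⁻_{D,E,f}(g)`. -/
def antiHalfB {X : Type*} [MetricSpace X] {G : Type*} [Group G] [MulAction G X]
    (S : Finset G) (f : G) (x₀ : X) (δ D E : ℝ) (g : G) : Set G :=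
  antiHalfSgn S f x₀ δ D (2 * E) (3 * D) ⌊180 * D⌋ g ∪
    antiHalfSgn S f x₀ δ D (2 * E) (3 * D) (-⌊180 * D⌋) g

theorem IsGeodesicParam.isGeodesicBetween {X : Type*} [MetricSpace X] {γ : ℝ → X} {a b s t : ℝ}
    (h : IsGeodesicParam γ a b) (has : a ≤ s) (hst : s ≤ t) (htb : t ≤ b) :
    IsGeodesicBetween (fun r => γ (s + r)) (γ s) (γ t) := by
  have hd : dist (γ s) (γ t) = t - s := by
    rw [h s ⟨has, hst.trans htb⟩ t ⟨has.trans hst, htb⟩, abs_sub_comm, abs_of_nonneg]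
    linarith
  refine ⟨by simp, by simp [hd], fun p hp q hq => ?_⟩
  rw [hd] at hp hq
  show dist (γ (s + p)) (γ (s + q)) = _
  rw [h (s + p) ⟨by linarith [hp.1], by linarith [hp.2]⟩ (s + q)
    ⟨by linarith [hq.1], by linarith [hq.2]⟩]
  congr 1
  ring

theorem IsGeodesicBetween.dist_left_add_dist_right {X : Type*} [MetricSpace X] {γ : ℝ → X}
    {x y : X} (h : IsGeodesicBetween γ x y) {t : ℝ} (ht : t ∈ Icc 0 (dist x y)) :
    dist (γ t) x = t ∧ dist (γ t) y = dist x y - t := by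
  obtain ⟨h0, h1, hγ⟩ := h
  constructor
  · conv_lhs => rw [← h0]
    rw [hγ t ht 0 ⟨le_rfl, dist_nonneg⟩, sub_zero, abs_of_nonneg ht.1]
  · have := hγ t ht (dist x y) ⟨dist_nonneg, le_rfl⟩
    rw [h1, abs_sub_comm, abs_of_nonneg (by linarith [ht.2])] at this
    exact this

theorem IsGeodesicBetween.smul {X : Type*} [MetricSpace X] {G : Type*} [Group G] [MulAction G X]
    (hiso : ∀ (g : G) (x y : X), dist (g • x) (g • y) = dist x y) (g : G) {γ : ℝ → X} {x y : X}
    (h : IsGeodesicBetween γ x y) : IsGeodesicBetween (fun t => g • γ t) (g • x) (g • y) := by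
  obtain ⟨h0, h1, hγ⟩ := h
  refine ⟨by simp [h0], by simp [hiso, h1], fun s hs t ht => ?_⟩
  rw [hiso] at hs ht ⊢
  exact hγ s hs t ht

theorem GromovHyperbolic.nonneg {X : Type*} [MetricSpace X] {δ : ℝ} (hX : GromovHyperbolic X δ)
    (x : X) : 0 ≤ δ := by
  obtain ⟨γ, hγ⟩ := hX.1 x x
  obtain ⟨u, -, hu⟩ := hX.2 x x x γ γ γ hγ hγ hγ 0 ⟨le_rfl, dist_nonneg⟩
  exact dist_nonneg.trans hu

/-- Thin quadrilaterals: a point of the side `[a, b]` is close to the opposite side `[p, q]`, or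
nearly lies on one of the two remaining sides. -/
theorem GromovHyperbolic.quadrilateral {X : Type*} [MetricSpace X] {δ : ℝ}
    (hX : GromovHyperbolic X δ) {a b p q : X} {α β : ℝ → X} (hα : IsGeodesicBetween α a b)
    (hβ : IsGeodesicBetween β p q) {t : ℝ} (ht : t ∈ Icc 0 (dist a b)) :
    (∃ s ∈ Icc 0 (dist p q), dist (α t) (β s) ≤ 2 * δ) ∨
      dist (α t) a + dist (α t) p ≤ dist a p + 4 * δ ∨
      dist (α t) b + dist (α t) q ≤ dist b q + 4 * δ := by
  have hδ := hX.nonneg a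
  obtain ⟨γaq, haq⟩ := hX.1 a q
  obtain ⟨γqb, hqb⟩ := hX.1 q b
  obtain ⟨γap, hap⟩ := hX.1 a p
  obtain ⟨y, ⟨r, hr, rfl⟩ | ⟨r, hr, rfl⟩, hy⟩ := hX.2 a q b α γaq γqb hα haq hqb t ht
  · obtain ⟨z, ⟨s, hs, rfl⟩ | ⟨s, hs, rfl⟩, hz⟩ := hX.2 a p q γaq γap β haq hap hβ r hr
    · obtain ⟨h1, h2⟩ := hap.dist_left_add_dist_right hs
      have h3 := dist_triangle (α t) (γaq r) (γap s)
      have h4 := dist_triangle (α t) (γap s) a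
      have h5 := dist_triangle (α t) (γap s) p
      exact Or.inr (Or.inl (by linarith))
    · have h3 := dist_triangle (α t) (γaq r) (β s)
      exact Or.inl ⟨s, hs, by linarith⟩
  · obtain ⟨h1, h2⟩ := hqb.dist_left_add_dist_right hr
    have h4 := dist_triangle (α t) (γqb r) q
    have h5 := dist_triangle (α t) (γqb r) b
    rw [dist_comm q b] at h2
    exact Or.inr (Or.inr (by linarith))

/-- Geodesics from a common origin stay close until they approach their endpoints. -/
theorem GromovHyperbolic.fellow_travel {X : Type*} [MetricSpace X] {δ : ℝ}
    (hX : GromovHyperbolic X δ) {γ η : ℝ → X} {τ σ c t : ℝ} (hγ : IsGeodesicParam γ 0 τ)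
    (hη : IsGeodesicParam η 0 σ) (hσ : 0 ≤ σ) (h0 : γ 0 = η 0) (hc : dist (γ τ) (η σ) ≤ c)
    (ht0 : 0 ≤ t) (ht : t < τ - c - δ) : t ≤ σ ∧ dist (γ t) (η t) ≤ 2 * δ := by
  have hδ := hX.nonneg (γ 0)
  have hc0 : 0 ≤ c := dist_nonneg.trans hc
  have hτ : 0 ≤ τ := by linarith
  have hγ' := hγ.isGeodesicBetween le_rfl hτ le_rfl
  have hη' := hη.isGeodesicBetween le_rfl hσ le_rfl
  rw [← h0] at hη'
  obtain ⟨ζ, hζ⟩ := hX.1 (η σ) (γ τ)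
  have dγ : dist (γ 0) (γ τ) = τ := by
    rw [hγ 0 ⟨le_rfl, hτ⟩ τ ⟨hτ, le_rfl⟩, zero_sub, abs_neg, abs_of_nonneg hτ]
  have dη : dist (γ 0) (η σ) = σ := by
    rw [h0, hη 0 ⟨le_rfl, hσ⟩ σ ⟨hσ, le_rfl⟩, zero_sub, abs_neg, abs_of_nonneg hσ]
  have dt : dist (γ 0) (γ t) = t := by
    rw [hγ 0 ⟨le_rfl, hτ⟩ t ⟨ht0, by linarith⟩, zero_sub, abs_neg, abs_of_nonneg ht0]
  have htσ : t ≤ σ := by linarith [dist_triangle (γ 0) (η σ) (γ τ), dist_comm (γ τ) (η σ)]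
  refine ⟨htσ, ?_⟩
  obtain ⟨y, ⟨r, hr, rfl⟩ | ⟨r, hr, rfl⟩, hy⟩ :=
    hX.2 _ _ _ _ _ _ hγ' hη' hζ t (by rw [dγ]; exact ⟨ht0, by linarith⟩)
  · rw [dη] at hr
    simp only [zero_add] at hy
    have dr : dist (γ 0) (η r) = r := by
      rw [h0, hη 0 ⟨le_rfl, hσ⟩ r hr, zero_sub, abs_neg, abs_of_nonneg hr.1]
    have h1 : dist (η r) (η t) ≤ δ := by
      rw [hη r hr t ⟨ht0, htσ⟩, abs_le]
      constructor
      · linarith [dist_triangle (γ 0) (η r) (γ t), dist_comm (γ t) (η r)]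
      · linarith [dist_triangle (γ 0) (γ t) (η r)]
    linarith [dist_triangle (γ t) (η r) (η t)]
  · exfalso
    simp only [zero_add] at hy
    obtain ⟨h1, h2⟩ := hζ.dist_left_add_dist_right hr
    have h3 := dist_triangle (γ t) (ζ r) (γ τ)
    have h4 := dist_triangle (γ 0) (γ t) (γ τ)
    linarith [hr.1, dist_comm (γ τ) (η σ)]

/-- A geodesic whose endpoints are close to two points of a geodesic line (in the positive
direction) follows this line at unit speed. -/
theorem GromovHyperbolic.dist_line_le {X : Type*} [MetricSpace X] {δ : ℝ}
    (hX : GromovHyperbolic X δ) {γ β : ℝ → X} {a b M c t : ℝ} (hγ : IsGeodesicParam γ a b)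
    (hβ : ∀ s t : ℝ, dist (β s) (β t) = |s - t|) (hM : 0 ≤ M) (ha : dist (γ a) (β 0) ≤ c)
    (hb : dist (γ b) (β M) ≤ c) (ht : t ∈ Icc a b) :
    dist (γ t) (β (t - a)) ≤ 3 * c + 8 * δ := by
  have hδ := hX.nonneg (γ 0)
  have hc : 0 ≤ c := dist_nonneg.trans ha
  have hab : a ≤ b := ht.1.trans ht.2
  have hα := hγ.isGeodesicBetween le_rfl hab le_rfl
  have dab : dist (γ a) (γ b) = b - a := by
    rw [hγ a ⟨le_rfl, hab⟩ b ⟨hab, le_rfl⟩, abs_sub_comm, abs_of_nonneg (by linarith)]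
  have dβ : dist (β 0) (β M) = M := by rw [hβ, zero_sub, abs_neg, abs_of_nonneg hM]
  have hβ' : IsGeodesicBetween β (β 0) (β M) :=
    ⟨rfl, by rw [dβ], fun s _ t _ => hβ s t⟩
  have key : ∃ s, 0 ≤ s ∧ dist (γ t) (β s) ≤ c + 4 * δ := by
    have hq := hX.quadrilateral hα hβ' (t := t - a)
      (by rw [dab]; exact ⟨by linarith [ht.1], by linarith [ht.2]⟩)
    simp only [add_sub_cancel] at hq
    obtain ⟨s, hs, h⟩ | h | h := hq
    · exact ⟨s, hs.1, by linarith⟩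
    · exact ⟨0, le_rfl, by linarith [dist_nonneg (x := γ t) (y := γ a)]⟩
    · exact ⟨M, hM, by linarith [dist_nonneg (x := γ t) (y := γ b)]⟩
  obtain ⟨s, hs0, hs⟩ := key
  have d1 : dist (γ t) (γ a) = t - a := by
    rw [hγ t ht a ⟨le_rfl, hab⟩, abs_of_nonneg (by linarith [ht.1])]
  have d2 : dist (β s) (β 0) = s := by rw [hβ, sub_zero, abs_of_nonneg hs0]
  have d3 : dist (β s) (β (t - a)) ≤ 2 * c + 4 * δ := by
    rw [hβ, abs_le]
    constructor
    · linarith [dist_triangle4 (γ t) (β s) (β 0) (γ a), dist_comm (β 0) (γ a)]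
    · linarith [dist_triangle4 (β s) (γ t) (γ a) (β 0), dist_comm (β s) (γ t)]
  linarith [dist_triangle (γ t) (β s) (β (t - a))]

theorem zpow_smul_axis {X : Type*} {G : Type*} [Group G] [MulAction G X] {f : G} {ℓ : ℝ → X}
    (haxis : ∀ t : ℝ, f • ℓ t = ℓ (t + 1)) (n : ℤ) (t : ℝ) : f ^ n • ℓ t = ℓ (t + n) := by
  induction n generalizing t with
  | zero => simp
  | succ n ih =>
    rw [zpow_add_one, mul_smul, haxis, ih]
    congr 1
    push_cast
    ring
  | pred n ih =>
    have h : f⁻¹ • ℓ t = ℓ (t - 1) := by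
      rw [inv_smul_eq_iff, haxis]
      simp
    rw [zpow_sub_one, mul_smul, h, ih]
    congr 1
    push_cast
    ring

theorem exists_list_length_eq_wordNorm {G : Type*} [Group G] {S : Finset G}
    (hgen : Subgroup.closure (S : Set G) = ⊤) (g : G) :
    ∃ l : List G, l.length = wordNorm S g ∧ (∀ x ∈ l, x ∈ S ∨ x⁻¹ ∈ S) ∧ l.prod = g := by
  have hg : g ∈ Subgroup.closure (S : Set G) := hgen ▸ Subgroup.mem_top g
  rw [← Subgroup.mem_toSubmonoid, Subgroup.closure_toSubmonoid] at hg
  obtain ⟨l, hl, hp⟩ := Submonoid.exists_list_of_mem_closure hg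
  exact Nat.sInf_mem (s := {n : ℕ | ∃ l : List G, l.length = n ∧ (∀ x ∈ l, x ∈ S ∨ x⁻¹ ∈ S) ∧
    l.prod = g}) ⟨l.length, l, rfl, hl, hp⟩

theorem finite_setOf_wordNorm_le {G : Type*} [Group G] {S : Finset G}
    (hgen : Subgroup.closure (S : Set G) = ⊤) (E : ℝ) :
    {g : G | (wordNorm S g : ℝ) ≤ E}.Finite := by
  have hT : {x : G | x ∈ S ∨ x⁻¹ ∈ S}.Finite := by
    refine (S.finite_toSet.union S.finite_toSet.inv).subset ?_
    rintro x (hx | hx)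
    · exact Or.inl hx
    · exact Or.inr hx
  have : Finite {x : G // x ∈ S ∨ x⁻¹ ∈ S} := hT
  refine ((List.finite_length_le {x : G // x ∈ S ∨ x⁻¹ ∈ S} ⌊E⌋₊).image
    (fun l => (l.map Subtype.val).prod)).subset ?_
  intro g hg
  obtain ⟨l, hl, hlS, hlp⟩ := exists_list_length_eq_wordNorm hgen g
  lift l to List {x : G // x ∈ S ∨ x⁻¹ ∈ S} using hlS
  refine ⟨l, ?_, hlp⟩
  rw [List.length_map] at hl
  show l.length ≤ ⌊E⌋₊
  rw [hl]
  exact Nat.le_floor hg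

/-- Under WPD, only finitely many elements move a long axis segment close to a given place. -/
theorem WPD.exists_finite {X : Type*} [MetricSpace X] {G : Type*} [Group G] [MulAction G X]
    (hiso : ∀ (g : G) (x y : X), dist (g • x) (g • y) = dist x y) {f : G} {x₀ : X}
    (hwpd : WPD f x₀) {C : ℝ} (hC : 0 ≤ C) : ∃ L : ℕ, ∀ p q : X,
      {g : G | dist (g • x₀) p ≤ C ∧ dist ((g * f ^ L) • x₀) q ≤ C}.Finite := by
  obtain ⟨L, -, hL⟩ := hwpd (2 * C + 1) (by linarith)
  refine ⟨L, fun p q => ?_⟩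
  obtain hempty | ⟨g₀, h₀, h₀'⟩ := Set.eq_empty_or_nonempty
    {g : G | dist (g • x₀) p ≤ C ∧ dist ((g * f ^ L) • x₀) q ≤ C}
  · rw [hempty]
    exact Set.finite_empty
  refine (hL.image (fun g => g₀ * g)).subset ?_
  rintro g ⟨hg, hg'⟩
  refine ⟨g₀⁻¹ * g, ⟨?_, ?_⟩, by simp⟩
  · rw [← hiso g₀, smul_smul, mul_inv_cancel_left]
    linarith [dist_triangle_right (g₀ • x₀) (g • x₀) p]
  · rw [← hiso g₀, smul_smul, smul_smul, mul_assoc, mul_inv_cancel_left]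
    linarith [dist_triangle_right ((g₀ * f ^ L) • x₀) ((g * f ^ L) • x₀) q]

/-- A geodesic from `x₀` which passes near `u • x₀` and then follows a long translate of the axis
of `f`, starting at `(u * h) • x₀` with `h` of bounded word norm. -/
structure AxisTrack {X : Type*} [MetricSpace X] {G : Type*} [Group G] [MulAction G X]
    (S : Finset G) (f : G) (x₀ : X) (δ E r : ℝ) (m : ℤ) (u : G) (γ : ℝ → X)
    (τ τ₁ τ₂ τ₃ : ℝ) (h : G) : Prop where
  nonneg : 0 ≤ τ₁
  le₁₂ : τ₁ ≤ τ₂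
  le₂₃ : τ₂ ≤ τ₃
  le₃ : τ₃ ≤ τ
  geodesic : IsGeodesicParam γ 0 τ
  zero : γ 0 = x₀
  norm_le : (wordNorm S h : ℝ) ≤ E
  near₁ : dist (γ τ₁) (u • x₀) < r
  near₂ : dist (γ τ₂) ((u * h) • x₀) < 20 * δ
  near₃ : dist (γ τ₃) ((u * h * f ^ m) • x₀) < 20 * δ

namespace AxisTrack

variable {X : Type*} [MetricSpace X] {G : Type*} [Group G] [MulAction G X]

theorem mono {S : Finset G} {f : G} {x₀ : X} {δ E r E' r' : ℝ} {m : ℤ} {u : G} {γ : ℝ → X}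
    {τ τ₁ τ₂ τ₃ : ℝ} {h : G} (H : AxisTrack S f x₀ δ E r m u γ τ τ₁ τ₂ τ₃ h) (hE : E ≤ E')
    (hr : r ≤ r') : AxisTrack S f x₀ δ E' r' m u γ τ τ₁ τ₂ τ₃ h :=
  { H with norm_le := H.norm_le.trans hE, near₁ := H.near₁.trans_le hr }

theorem of_mem_smul (hiso : ∀ (g : G) (x y : X), dist (g • x) (g • y) = dist x y)
    {S : Finset G} {f : G} {x₀ : X} {δ D E r : ℝ} {m : ℤ} {u w : G}
    (hw : w ∈ u • antiHalfSgn S f x₀ δ D E r m u⁻¹) :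
    ∃ (γ : ℝ → X) (τ τ₁ τ₂ τ₃ : ℝ) (h : G),
      AxisTrack S f x₀ δ E r m u γ τ τ₁ τ₂ τ₃ h ∧ dist (γ τ) (w • x₀) < 5 * D := by
  rw [Set.mem_smul_set_iff_inv_smul_mem, smul_eq_mul] at hw
  obtain ⟨γ, τ, τ₁, τ₂, τ₃, h, h0, h12, h23, h3, hγ, hγ0, hh, n1, n2, n3, n4⟩ := hw
  refine ⟨fun t => u • γ t, τ, τ₁, τ₂, τ₃, h, ⟨h0, h12, h23, h3, ?_, ?_, hh, ?_, ?_, ?_⟩, ?_⟩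
  · intro s hs t ht
    rw [hiso]
    exact hγ s hs t ht
  · simp [hγ0]
  · simpa only [hiso] using n1
  · simpa only [hiso, mul_smul] using n2
  · simpa only [hiso, mul_smul] using n3
  · rw [← hiso u, smul_smul, mul_inv_cancel_left] at n4
    exact n4

theorem mem_smul (hiso : ∀ (g : G) (x y : X), dist (g • x) (g • y) = dist x y)
    {S : Finset G} {f : G} {x₀ : X} {δ D E r : ℝ} {m : ℤ} {u v : G} {γ : ℝ → X}
    {τ τ₁ τ₂ τ₃ t : ℝ} {h : G} (H : AxisTrack S f x₀ δ E r m u γ τ τ₁ τ₂ τ₃ h)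
    (ht₃ : τ₃ ≤ t) (ht : t ≤ τ) (hv : dist (γ t) (v • x₀) < 5 * D) :
    v ∈ u • antiHalfSgn S f x₀ δ D E r m u⁻¹ := by
  rw [Set.mem_smul_set_iff_inv_smul_mem, smul_eq_mul]
  refine ⟨fun t => u⁻¹ • γ t, t, τ₁, τ₂, τ₃, h, H.nonneg, H.le₁₂, H.le₂₃, ht₃, ?_, ?_,
    H.norm_le, ?_, ?_, ?_, ?_⟩
  · intro s hs s' hs'
    rw [hiso]
    exact H.geodesic s ⟨hs.1, hs.2.trans ht⟩ s' ⟨hs'.1, hs'.2.trans ht⟩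
  · simp [H.zero]
  · rw [← hiso u, smul_inv_smul]
    exact H.near₁
  · rw [← hiso u, smul_inv_smul, smul_smul]
    exact H.near₂
  · rw [← hiso u, smul_inv_smul, smul_smul, ← mul_assoc]
    exact H.near₃
  · rw [← hiso u, smul_inv_smul, smul_smul, mul_inv_cancel_left]
    exact hv

theorem dist_zpow (hiso : ∀ (g : G) (x y : X), dist (g • x) (g • y) = dist x y)
    {f : G} {ℓ : ℝ → X} (hgeo : ∀ s t : ℝ, dist (ℓ s) (ℓ t) = |s - t|)
    (haxis : ∀ t : ℝ, f • ℓ t = ℓ (t + 1)) {t₀ : ℝ} {S : Finset G} {δ E r : ℝ} {m : ℤ} {u : G}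
    {γ : ℝ → X} {τ τ₁ τ₂ τ₃ : ℝ} {h : G}
    (H : AxisTrack S f (ℓ t₀) δ E r m u γ τ τ₁ τ₂ τ₃ h) :
    |(|(m : ℝ)| - (τ₃ - τ₂))| ≤ 40 * δ := by
  have d1 : dist ((u * h) • ℓ t₀) ((u * h * f ^ m) • ℓ t₀) = |(m : ℝ)| := by
    rw [mul_smul (u * h) (f ^ m), hiso, zpow_smul_axis haxis, hgeo, sub_add_cancel_left, abs_neg]
  have h0 := H.nonneg
  have h12 := H.le₁₂
  have h23 := H.le₂₃
  have h3 := H.le₃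
  have d2 : dist (γ τ₂) (γ τ₃) = τ₃ - τ₂ := by
    rw [H.geodesic τ₂ ⟨by linarith, by linarith⟩ τ₃ ⟨by linarith, by linarith⟩, abs_sub_comm,
      abs_of_nonneg (by linarith)]
  have n2 := H.near₂
  have n3 := H.near₃
  rw [abs_le]
  constructor
  · linarith [dist_triangle4_right (γ τ₂) (γ τ₃) ((u * h) • ℓ t₀) ((u * h * f ^ m) • ℓ t₀)]
  · linarith [dist_triangle4_left (γ τ₂) (γ τ₃) ((u * h) • ℓ t₀) ((u * h * f ^ m) • ℓ t₀)]

theorem dist_lt_of_near {S : Finset G} {f : G} {x₀ : X} {δ D E r : ℝ} {m : ℤ} {u v w : G}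
    {γ : ℝ → X} {τ τ₁ τ₂ τ₃ t : ℝ} {h : G} (H : AxisTrack S f x₀ δ E r m u γ τ τ₁ τ₂ τ₃ h)
    (hw : dist (γ τ) (w • x₀) < 5 * D) (hr : r ≤ 3 * D) (hlong : 178 * D ≤ τ₃ - τ₂)
    (ht₃ : τ₃ ≤ t) (ht : t ≤ τ) (hv : dist (γ t) (v • x₀) < 5 * D) :
    dist (w • x₀) (v • x₀) < dist (w • x₀) (u • x₀) := by
  have h0 := H.nonneg
  have h12 := H.le₁₂
  have h23 := H.le₂₃
  have n1 := H.near₁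
  have d1 : dist (γ τ) (γ t) = τ - t := by
    rw [H.geodesic τ ⟨by linarith, by linarith⟩ t ⟨by linarith, by linarith⟩,
      abs_of_nonneg (by linarith)]
  have d2 : dist (γ τ) (γ τ₁) = τ - τ₁ := by
    rw [H.geodesic τ ⟨by linarith, by linarith⟩ τ₁ ⟨by linarith, by linarith⟩,
      abs_of_nonneg (by linarith)]
  have hD : 0 < D := by linarith [dist_nonneg (x := γ τ) (y := w • x₀)]
  have e1 := dist_triangle4_left (γ τ) (γ t) (w • x₀) (v • x₀)
  have e2 := dist_triangle4_right (γ τ) (γ τ₁) (w • x₀) (u • x₀)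
  linarith

/-- On its axis part, an axis track is close to two orbit points `g • x₀` and `(g * f ^ L) • x₀`
at prescribed times differing by `L`, in one of the two possible orders. -/
theorem exists_near_axis {δ : ℝ} (hX : GromovHyperbolic X δ)
    (hiso : ∀ (g : G) (x y : X), dist (g • x) (g • y) = dist x y)
    {f : G} {ℓ : ℝ → X} (hgeo : ∀ s t : ℝ, dist (ℓ s) (ℓ t) = |s - t|)
    (haxis : ∀ t : ℝ, f • ℓ t = ℓ (t + 1)) {t₀ : ℝ} {S : Finset G} {E r : ℝ} {m : ℤ} {u : G}
    {γ : ℝ → X} {τ τ₁ τ₂ τ₃ : ℝ} {h : G}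
    (H : AxisTrack S f (ℓ t₀) δ E r m u γ τ τ₁ τ₂ τ₃ h) {s : ℝ} {L : ℕ} (hs : τ₂ ≤ s)
    (hsL : s + L ≤ τ₃) :
    ∃ j : ℤ, |(j : ℝ)| ≤ τ₃ - τ₂ ∧
      ((dist (γ s) ((u * h * f ^ j) • ℓ t₀) ≤ 68 * δ + 1 ∧
          dist (γ (s + L)) ((u * h * f ^ j * f ^ L) • ℓ t₀) ≤ 68 * δ + 1) ∨
        (dist (γ (s + L)) ((u * h * f ^ j) • ℓ t₀) ≤ 68 * δ + 1 ∧
          dist (γ s) ((u * h * f ^ j * f ^ L) • ℓ t₀) ≤ 68 * δ + 1)) := by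
  have hL : (0 : ℝ) ≤ L := Nat.cast_nonneg L
  have hγ : IsGeodesicParam γ τ₂ τ₃ := fun p hp q hq =>
    H.geodesic p ⟨by linarith [H.nonneg, H.le₁₂, hp.1], hp.2.trans H.le₃⟩ q
      ⟨by linarith [H.nonneg, H.le₁₂, hq.1], hq.2.trans H.le₃⟩
  have horb : ∀ j : ℤ, (u * h * f ^ j) • ℓ t₀ = (u * h) • ℓ (t₀ + j) := fun j => by
    rw [mul_smul (u * h), zpow_smul_axis haxis]
  have horbL : ∀ j : ℤ, (u * h * f ^ j * f ^ L) • ℓ t₀ = (u * h) • ℓ (t₀ + (j + L : ℤ)) :=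
    fun j => by rw [← horb, zpow_add, zpow_natCast, mul_assoc (u * h)]
  have key : ∃ ε : ℤ, (ε = 1 ∨ ε = -1) ∧ (m : ℝ) = ε * |(m : ℝ)| := by
    rcases le_total (0 : ℝ) m with hm | hm
    · exact ⟨1, Or.inl rfl, by rw [abs_of_nonneg hm]; simp⟩
    · exact ⟨-1, Or.inr rfl, by rw [abs_of_nonpos hm]; simp⟩
  obtain ⟨ε, hε, hm⟩ := key
  have hεabs : |(ε : ℝ)| = 1 := by rcases hε with rfl | rfl <;> simp
  have hβ : ∀ p q : ℝ, dist ((u * h) • ℓ (t₀ + ε * p)) ((u * h) • ℓ (t₀ + ε * q)) = |p - q| := by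
    intro p q
    rw [hiso, hgeo, add_sub_add_left_eq_sub, ← mul_sub, abs_mul, hεabs, one_mul]
  have hline : ∀ t ∈ Icc τ₂ τ₃, dist (γ t) ((u * h) • ℓ (t₀ + ε * (t - τ₂))) ≤ 68 * δ := by
    intro t ht
    have := hX.dist_line_le (β := fun p => (u * h) • ℓ (t₀ + ε * p)) (c := 20 * δ) hγ hβ
      (abs_nonneg (m : ℝ)) (by simpa using H.near₂.le)
      (by
        show dist (γ τ₃) ((u * h) • ℓ (t₀ + ε * |(m : ℝ)|)) ≤ _
        rw [← hm, ← horb]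
        exact H.near₃.le) ht
    linarith
  have hround : ∀ t ∈ Icc τ₂ τ₃, ∀ a : ℤ, |t - τ₂ - a| ≤ 1 →
      dist (γ t) ((u * h) • ℓ (t₀ + (ε * a : ℤ))) ≤ 68 * δ + 1 := by
    intro t ht a ha
    have h1 := hβ (t - τ₂) a
    push_cast
    linarith [hline t ht, dist_triangle (γ t) ((u * h) • ℓ (t₀ + ε * (t - τ₂)))
      ((u * h) • ℓ (t₀ + ε * a))]
  have ha0 : 0 ≤ ⌊s - τ₂⌋ := Int.floor_nonneg.2 (by linarith)
  have ha0' : (0 : ℝ) ≤ ⌊s - τ₂⌋ := by exact_mod_cast ha0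
  have ha1 := Int.floor_le (s - τ₂)
  have ha2 := Int.lt_floor_add_one (s - τ₂)
  have r1 := hround s ⟨hs, by linarith⟩ ⌊s - τ₂⌋ (by rw [abs_le]; constructor <;> linarith)
  have r2 := hround (s + L) ⟨by linarith, hsL⟩ (⌊s - τ₂⌋ + L)
    (by push_cast; rw [abs_le]; constructor <;> linarith)
  rcases hε with rfl | rfl
  · refine ⟨⌊s - τ₂⌋, ?_, Or.inl ⟨?_, ?_⟩⟩
    · rw [abs_of_nonneg ha0']
      linarith
    · rw [horb]
      simpa using r1
    · rw [horbL]
      simpa using r2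
  · refine ⟨-(⌊s - τ₂⌋ + L), ?_, Or.inr ⟨?_, ?_⟩⟩
    · push_cast
      rw [abs_neg, abs_of_nonneg (by linarith)]
      linarith
    · rw [horb]
      rwa [neg_one_mul] at r2
    · rw [horbL, show -(⌊s - τ₂⌋ + (L : ℤ)) + L = -⌊s - τ₂⌋ by ring]
      rwa [neg_one_mul] at r1

/-- A point of a track between `u • x₀` and the end of the axis part is close to the translate of
a given geodesic, or the track is still near `u • x₀`. -/
theorem near_or_near {δ : ℝ} (hX : GromovHyperbolic X δ)
    (hiso : ∀ (g : G) (x y : X), dist (g • x) (g • y) = dist x y)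
    {f : G} {x₀ : X} {S : Finset G} {E r : ℝ} {m : ℤ} {u : G}
    {γ : ℝ → X} {τ τ₁ τ₂ τ₃ : ℝ} {h : G}
    (H : AxisTrack S f x₀ δ E r m u γ τ τ₁ τ₂ τ₃ h) {ζ : ℝ → X}
    (hζ : IsGeodesicBetween ζ x₀ ((h * f ^ m) • x₀)) {s : ℝ} (hs₁ : τ₁ ≤ s)
    (hs₃ : s < τ₃ - 24 * δ) :
    (∃ n : ℕ, n ≤ ⌊dist x₀ ((h * f ^ m) • x₀)⌋₊ ∧ dist (γ s) (u • ζ n) ≤ 2 * δ + 1) ∨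
      (s - τ₁) + dist (γ s) (u • x₀) ≤ r + 4 * δ := by
  have h0 := H.nonneg
  have h12 := H.le₁₂
  have h23 := H.le₂₃
  have h3 := H.le₃
  have hδ := hX.nonneg x₀
  have n1 := H.near₁
  have n3 := H.near₃
  have hα := H.geodesic.isGeodesicBetween h0 (h12.trans h23) h3
  have hβ := hζ.smul hiso u
  rw [smul_smul, ← mul_assoc] at hβ
  have d13 : dist (γ τ₁) (γ τ₃) = τ₃ - τ₁ := by
    rw [H.geodesic τ₁ ⟨by linarith, by linarith⟩ τ₃ ⟨by linarith, by linarith⟩, abs_sub_comm,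
      abs_of_nonneg (by linarith)]
  have d1 : dist (γ s) (γ τ₁) = s - τ₁ := by
    rw [H.geodesic s ⟨by linarith, by linarith⟩ τ₁ ⟨by linarith, by linarith⟩,
      abs_of_nonneg (by linarith)]
  have d3 : dist (γ s) (γ τ₃) = τ₃ - s := by
    rw [H.geodesic s ⟨by linarith, by linarith⟩ τ₃ ⟨by linarith, by linarith⟩, abs_sub_comm,
      abs_of_nonneg (by linarith)]
  have hq := hX.quadrilateral hα hβ (t := s - τ₁)
    (by rw [d13]; exact ⟨by linarith, by linarith⟩)
  simp only [add_sub_cancel] at hq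
  obtain ⟨p, hp, hd⟩ | hd | hd := hq
  · have e : dist (u • x₀) ((u * h * f ^ m) • x₀) = dist x₀ ((h * f ^ m) • x₀) := by
      rw [mul_assoc, mul_smul u, hiso]
    rw [e] at hp
    refine Or.inl ⟨⌊p⌋₊, Nat.floor_le_floor hp.2, ?_⟩
    have f1 := Nat.floor_le hp.1
    have f2 := Nat.lt_floor_add_one p
    have := hζ.2.2 p hp ⌊p⌋₊ ⟨Nat.cast_nonneg _, f1.trans hp.2⟩
    rw [abs_of_nonneg (by linarith), ← hiso u] at this
    linarith [dist_triangle (γ s) (u • ζ p) (u • ζ ⌊p⌋₊)]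
  · exact Or.inr (by linarith)
  · exfalso
    linarith [dist_nonneg (x := γ s) (y := (u * h * f ^ m) • x₀)]

/-- Two tracks with nearby endpoints: if the axis part of the first one ends first, then it can be
cut after its axis part to end near `v • x₀`, or `v⁻¹ * u` satisfies a finiteness condition. -/
theorem exists_near_or {δ : ℝ} (hX : GromovHyperbolic X δ)
    (hiso : ∀ (g : G) (x y : X), dist (g • x) (g • y) = dist x y)
    {f : G} {ℓ : ℝ → X} (hgeo : ∀ s t : ℝ, dist (ℓ s) (ℓ t) = |s - t|)
    (haxis : ∀ t : ℝ, f • ℓ t = ℓ (t + 1)) {t₀ : ℝ} {S : Finset G} {ζ : G → ℝ → X}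
    (hζ : ∀ k, IsGeodesicBetween (ζ k) (ℓ t₀) (k • ℓ t₀)) {D E : ℝ} {m m' : ℤ} {u v : G}
    {γ η : ℝ → X} {τ τ₁ τ₂ τ₃ σ σ₁ σ₂ σ₃ : ℝ} {h h' : G} {L : ℕ}
    (H : AxisTrack S f (ℓ t₀) δ E (3 * D) m u γ τ τ₁ τ₂ τ₃ h)
    (H' : AxisTrack S f (ℓ t₀) δ E (3 * D) m' v η σ σ₁ σ₂ σ₃ h')
    (hend : dist (γ τ) (η σ) ≤ 10 * D) (hLD : 2 * (L : ℝ) ≤ D) (hδD : 100 * δ + 1 ≤ D)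
    (hγ : 178 * D ≤ τ₃ - τ₂) (hη : 178 * D ≤ σ₃ - σ₂) (hle : τ₃ ≤ σ₃) :
    (∃ t, τ₃ ≤ t ∧ t ≤ τ ∧ dist (γ t) (v • ℓ t₀) < 5 * D) ∨
      ∃ j : ℤ, |(j : ℝ)| ≤ τ₃ - τ₂ ∧
        ∃ n ≤ ⌊dist (ℓ t₀) ((h' * f ^ m') • ℓ t₀)⌋₊,
        ∃ n' ≤ ⌊dist (ℓ t₀) ((h' * f ^ m') • ℓ t₀)⌋₊,
          dist ((v⁻¹ * u * (h * f ^ j)) • ℓ t₀) (ζ (h' * f ^ m') n) ≤ 72 * δ + 2 ∧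
          dist ((v⁻¹ * u * (h * f ^ j) * f ^ L) • ℓ t₀) (ζ (h' * f ^ m') n') ≤ 72 * δ + 2 := by
  have hδ := hX.nonneg (ℓ t₀)
  have hL : (0 : ℝ) ≤ L := Nat.cast_nonneg L
  have a0 := H.nonneg
  have a12 := H.le₁₂
  have a3 := H.le₃
  have b0 := H'.nonneg
  have b12 := H'.le₁₂
  have b3 := H'.le₃
  have bn := H'.near₁
  have hstart : γ 0 = η 0 := H.zero.trans H'.zero.symm
  have hτσ : σ ≤ τ + 10 * D := by
    have e1 := H.geodesic 0 ⟨le_rfl, by linarith⟩ τ ⟨by linarith, le_rfl⟩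
    have e2 := H'.geodesic 0 ⟨le_rfl, by linarith⟩ σ ⟨by linarith, le_rfl⟩
    rw [zero_sub, abs_neg, abs_of_nonneg (by linarith)] at e1 e2
    rw [← hstart] at e2
    linarith [dist_triangle (γ 0) (γ τ) (η σ)]
  have hft : ∀ t, 0 ≤ t → t ≤ τ - 11 * D → dist (γ t) (η t) ≤ 2 * δ := fun t ht0 ht =>
    (hX.fellow_travel H.geodesic H'.geodesic (by linarith) hstart hend ht0 (by linarith)).2
  rcases le_or_gt (τ₃ - D) σ₁ with hσ₁ | hσ₁
  · refine Or.inl ⟨max τ₃ σ₁, le_max_left _ _, max_le a3 (by linarith), ?_⟩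
    have hm : max τ₃ σ₁ ≤ σ₁ + D := max_le (by linarith) (by linarith)
    have e := H.geodesic (max τ₃ σ₁) ⟨le_max_of_le_right b0, max_le a3 (by linarith)⟩ σ₁
      ⟨b0, by linarith⟩
    rw [abs_of_nonneg (by linarith [le_max_right τ₃ σ₁])] at e
    linarith [dist_triangle4 (γ (max τ₃ σ₁)) (γ σ₁) (η σ₁) (v • ℓ t₀), hft σ₁ b0 (by linarith)]
  obtain ⟨T, hT3, hT, hTcase⟩ : ∃ T, T ≤ τ₃ ∧ T ≤ τ - 11 * D ∧ (T = τ₃ ∨ T = τ - 11 * D) :=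
    ⟨min τ₃ (τ - 11 * D), min_le_left _ _, min_le_right _ _, min_choice _ _⟩
  have hTlow : τ₂ + 100 * D ≤ T := by rcases hTcase with rfl | rfl <;> linarith
  have hTσ : σ₁ ≤ T - D := by rcases hTcase with rfl | rfl <;> linarith
  have hbad : ∀ t, T - D ≤ t → t ≤ T →
      (t - σ₁) + dist (η t) (v • ℓ t₀) ≤ 3 * D + 4 * δ →
      ∃ t, τ₃ ≤ t ∧ t ≤ τ ∧ dist (γ t) (v • ℓ t₀) < 5 * D := by
    intro t ht1 ht2 ht
    have hd := dist_nonneg (x := η t) (y := v • ℓ t₀)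
    have hT' : T = τ₃ := by
      refine hTcase.resolve_right fun hT' => ?_
      linarith
    refine ⟨τ₃, le_rfl, a3, ?_⟩
    have e := H.geodesic τ₃ ⟨by linarith, a3⟩ t ⟨by linarith, by linarith⟩
    rw [abs_of_nonneg (by linarith)] at e
    linarith [dist_triangle4 (γ τ₃) (γ t) (η t) (v • ℓ t₀), hft t (by linarith) (by linarith)]
  rcases H'.near_or_near hX hiso (hζ _) (s := T - D) hTσ (by linarith) with ⟨n, hn, hdn⟩ | hb
  swap
  · exact Or.inl (hbad _ le_rfl (by linarith) hb)
  rcases H'.near_or_near hX hiso (hζ _) (s := T - D + L) (by linarith) (by linarith) with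
    ⟨n', hn', hdn'⟩ | hb
  swap
  · exact Or.inl (hbad _ (by linarith) (by linarith) hb)
  have hf := hft (T - D) (by linarith) (by linarith)
  have hf' := hft (T - D + L) (by linarith) (by linarith)
  obtain ⟨j, hj, hjd⟩ := H.exists_near_axis hX hiso hgeo haxis (s := T - D) (L := L)
    (by linarith) (by linarith)
  have htr : ∀ (g : G) (y : X), dist ((v⁻¹ * g) • ℓ t₀) y = dist (g • ℓ t₀) (v • y) := by
    intro g y
    rw [← hiso v, smul_smul, mul_inv_cancel_left]
  refine Or.inr ⟨j, hj, ?_⟩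
  simp only [mul_assoc v⁻¹, htr]
  simp only [← mul_assoc u]
  rcases hjd with ⟨h1, h2⟩ | ⟨h1, h2⟩
  · refine ⟨n, hn, n', hn', ?_, ?_⟩
    · rw [dist_comm] at h1
      linarith [dist_triangle4 ((u * h * f ^ j) • ℓ t₀) (γ (T - D)) (η (T - D))
        (v • ζ (h' * f ^ m') n)]
    · rw [dist_comm] at h2
      linarith [dist_triangle4 ((u * h * f ^ j * f ^ L) • ℓ t₀) (γ (T - D + L)) (η (T - D + L))
        (v • ζ (h' * f ^ m') n')]
  · refine ⟨n', hn', n, hn, ?_, ?_⟩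
    · rw [dist_comm] at h1
      linarith [dist_triangle4 ((u * h * f ^ j) • ℓ t₀) (γ (T - D + L)) (η (T - D + L))
        (v • ζ (h' * f ^ m') n')]
    · rw [dist_comm] at h2
      linarith [dist_triangle4 ((u * h * f ^ j * f ^ L) • ℓ t₀) (γ (T - D)) (η (T - D))
        (v • ζ (h' * f ^ m') n)]

end AxisTrack

/-- **Lineage is linear** (Observation 8.4 of the paper). -/
theorem antiHalf_lineage
    {X : Type*} [MetricSpace X] {G : Type*} [Group G] [MulAction G X]
    (δ : ℝ) (hX : GromovHyperbolic X δ)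
    (hiso : ∀ (g : G) (x y : X), dist (g • x) (g • y) = dist x y)
    (hnvc : ¬ VirtuallyCyclic G)
    (f : G) (ℓ : ℝ → X) (hgeo : ∀ s t : ℝ, dist (ℓ s) (ℓ t) = |s - t|)
    (haxis : ∀ t : ℝ, f • ℓ t = ℓ (t + 1))
    (x₀ : X) (hx₀ : x₀ ∈ Set.range ℓ) (hwpd : WPD f x₀)
    (S : Finset G) (hgen : Subgroup.closure (S : Set G) = ⊤) :
    ∃ D₀ : ℝ, 0 < D₀ ∧ ∀ D : ℝ, D₀ ≤ D → (∃ m : ℤ, (m : ℝ) = 200 * D) →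
      ∀ E : ℝ, 0 < E → ∃ R : ℝ, 0 < R ∧
        ∀ u v w : G,
          w ∈ u • antiHalfA S f x₀ δ D E u⁻¹ →
          w ∈ v • antiHalfB S f x₀ δ D E v⁻¹ →
          (v ∈ u • antiHalfA S f x₀ δ D E u⁻¹ ∧
              dist (w • x₀) (v • x₀) < dist (w • x₀) (u • x₀)) ∨
          (u ∈ v • antiHalfB S f x₀ δ D E v⁻¹ ∧
              dist (w • x₀) (u • x₀) < dist (w • x₀) (v • x₀)) ∨
          (wordDist S u v : ℝ) ≤ R := by
  obtain ⟨t₀, rfl⟩ := hx₀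
  have hδ := hX.nonneg (ℓ t₀)
  obtain ⟨L, hL⟩ := hwpd.exists_finite hiso (C := 72 * δ + 2) (by linarith)
  choose ζ hζ using fun k : G => hX.1 (ℓ t₀) (k • ℓ t₀)
  have hL0 : (0 : ℝ) ≤ L := Nat.cast_nonneg L
  refine ⟨100 * δ + 1 + 2 * L, by linarith, fun D hD _ E hE => ?_⟩
  have hball := finite_setOf_wordNorm_le hgen (2 * E)
  let J : Set ℤ := Icc (-⌈201 * D⌉) ⌈201 * D⌉
  let K : Set G := image2 (fun h j => h * f ^ j) {g : G | (wordNorm S g : ℝ) ≤ 2 * E} J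
  have hJ : ∀ j : ℤ, |(j : ℝ)| ≤ 201 * D → j ∈ J := fun j hj => by
    have h1 : |(j : ℝ)| ≤ ⌈201 * D⌉ := hj.trans (Int.le_ceil _)
    exact abs_le.1 (by exact_mod_cast h1)
  have hK : K.Finite := hball.image2 _ (Set.finite_Icc _ _)
  let Y : Set G := ⋃ k ∈ K, ⋃ n ∈ Iic ⌊dist (ℓ t₀) (k • ℓ t₀)⌋₊,
    ⋃ n' ∈ Iic ⌊dist (ℓ t₀) (k • ℓ t₀)⌋₊, image2 (fun g p => g * p⁻¹)
      {g : G | dist (g • ℓ t₀) (ζ k n) ≤ 72 * δ + 2 ∧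
        dist ((g * f ^ L) • ℓ t₀) (ζ k n') ≤ 72 * δ + 2} K
  have hY : Y.Finite := hK.biUnion fun k _ => (Set.finite_Iic _).biUnion fun n _ =>
    (Set.finite_Iic _).biUnion fun n' _ => (hL _ _).image2 _ hK
  obtain ⟨B, hB⟩ := ((hY.union hY.inv).image (wordNorm S)).bddAbove
  have hB' : ∀ g ∈ Y ∪ Y⁻¹, (wordNorm S g : ℝ) ≤ B := fun g hg => by
    exact_mod_cast hB (mem_image_of_mem _ hg)
  have hkey : ∀ {m m' : ℤ} {u v : G} {γ η : ℝ → X} {τ τ₁ τ₂ τ₃ σ σ₁ σ₂ σ₃ : ℝ} {h h' : G},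
      AxisTrack S f (ℓ t₀) δ (2 * E) (3 * D) m u γ τ τ₁ τ₂ τ₃ h →
      AxisTrack S f (ℓ t₀) δ (2 * E) (3 * D) m' v η σ σ₁ σ₂ σ₃ h' →
      dist (γ τ) (η σ) ≤ 10 * D → 178 * D ≤ τ₃ - τ₂ → 178 * D ≤ σ₃ - σ₂ →
      |(m : ℝ)| ≤ 200 * D → |(m' : ℝ)| ≤ 200 * D → τ₃ ≤ σ₃ →
      (∃ t, τ₃ ≤ t ∧ t ≤ τ ∧ dist (γ t) (v • ℓ t₀) < 5 * D) ∨ v⁻¹ * u ∈ Y := by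
    intro m m' u v γ η τ τ₁ τ₂ τ₃ σ σ₁ σ₂ σ₃ h h' H H' hend hγ hη hm hm' hle
    refine (H.exists_near_or hX hiso hgeo haxis hζ H' hend (L := L) (by linarith) (by linarith)
      hγ hη hle).imp_right ?_
    rintro ⟨j, hj, n, hn, n', hn', hg, hg'⟩
    have hlen := (abs_le.1 (H.dist_zpow hiso hgeo haxis)).1
    simp only [Y, mem_iUnion]
    exact ⟨h' * f ^ m', ⟨h', H'.norm_le, m', hJ m' (by linarith), rfl⟩, n, hn, n', hn',
      v⁻¹ * u * (h * f ^ j), ⟨hg, hg'⟩, h * f ^ j, ⟨h, H.norm_le, j, hJ j (by linarith), rfl⟩,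
      mul_inv_cancel_right _ _⟩
  have hfloor : ∀ (c : ℝ) (m : ℤ), 180 ≤ c → c ≤ 200 → m = ⌊c * D⌋ ∨ m = -⌊c * D⌋ →
      179 * D ≤ |(m : ℝ)| ∧ |(m : ℝ)| ≤ 200 * D := by
    intro c m hc hc' hm
    have h1 := Int.floor_le (c * D)
    have h2 := Int.lt_floor_add_one (c * D)
    have h3 : 180 * D ≤ c * D := by gcongr; linarith
    have h4 : c * D ≤ 200 * D := by gcongr; linarith
    have : |(m : ℝ)| = ⌊c * D⌋ := by
      have h0 : (0 : ℝ) ≤ ⌊c * D⌋ := by linarith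
      rcases hm with rfl | rfl
      · exact abs_of_nonneg h0
      · push_cast
        rw [abs_neg, abs_of_nonneg h0]
    rw [this]
    constructor <;> linarith
  refine ⟨max B 1, by positivity, fun u v w hu hv => ?_⟩
  rw [antiHalfA, smul_set_union] at hu ⊢
  rw [antiHalfB, smul_set_union] at hv ⊢
  obtain ⟨m, hm, hu, hu'⟩ : ∃ m : ℤ, (m = ⌊200 * D⌋ ∨ m = -⌊200 * D⌋) ∧
      w ∈ u • antiHalfSgn S f (ℓ t₀) δ D E (1.1 * D) m u⁻¹ ∧
      u • antiHalfSgn S f (ℓ t₀) δ D E (1.1 * D) m u⁻¹ ⊆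
        u • antiHalfSgn S f (ℓ t₀) δ D E (1.1 * D) ⌊200 * D⌋ u⁻¹ ∪
          u • antiHalfSgn S f (ℓ t₀) δ D E (1.1 * D) (-⌊200 * D⌋) u⁻¹ := by
    rcases hu with hu | hu
    · exact ⟨_, Or.inl rfl, hu, subset_union_left⟩
    · exact ⟨_, Or.inr rfl, hu, subset_union_right⟩
  obtain ⟨m', hm', hv, hv'⟩ : ∃ m : ℤ, (m = ⌊180 * D⌋ ∨ m = -⌊180 * D⌋) ∧
      w ∈ v • antiHalfSgn S f (ℓ t₀) δ D (2 * E) (3 * D) m v⁻¹ ∧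
      v • antiHalfSgn S f (ℓ t₀) δ D (2 * E) (3 * D) m v⁻¹ ⊆
        v • antiHalfSgn S f (ℓ t₀) δ D (2 * E) (3 * D) ⌊180 * D⌋ v⁻¹ ∪
          v • antiHalfSgn S f (ℓ t₀) δ D (2 * E) (3 * D) (-⌊180 * D⌋) v⁻¹ := by
    rcases hv with hv | hv
    · exact ⟨_, Or.inl rfl, hv, subset_union_left⟩
    · exact ⟨_, Or.inr rfl, hv, subset_union_right⟩
  obtain ⟨hmlow, hmup⟩ := hfloor 200 m (by norm_num) le_rfl hm
  obtain ⟨hmlow', hmup'⟩ := hfloor 180 m' le_rfl (by norm_num) hm'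
  obtain ⟨γ, τ, τ₁, τ₂, τ₃, h, H, hwγ⟩ := AxisTrack.of_mem_smul hiso hu
  obtain ⟨η, σ, σ₁, σ₂, σ₃, h', H', hwη⟩ := AxisTrack.of_mem_smul hiso hv
  have hend : dist (γ τ) (η σ) ≤ 10 * D := by
    linarith [dist_triangle_right (γ τ) (η σ) (w • ℓ t₀)]
  have Hmono := H.mono (E' := 2 * E) (r' := 3 * D) (by linarith) (by linarith)
  have hγ : 178 * D ≤ τ₃ - τ₂ := by linarith [(abs_le.1 (H.dist_zpow hiso hgeo haxis)).2]
  have hη : 178 * D ≤ σ₃ - σ₂ := by linarith [(abs_le.1 (H'.dist_zpow hiso hgeo haxis)).2]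
  rcases le_total τ₃ σ₃ with hle | hle
  · rcases hkey Hmono H' hend hγ hη hmup hmup' hle with ⟨t, ht₃, ht, hd⟩ | hmem
    · exact Or.inl ⟨hu' (H.mem_smul hiso ht₃ ht hd),
        Hmono.dist_lt_of_near hwγ le_rfl hγ ht₃ ht hd⟩
    · refine Or.inr (Or.inr ((hB' _ (Or.inr ?_)).trans (le_max_left _ _)))
      simpa using hmem
  · rcases hkey H' Hmono (by rwa [dist_comm]) hη hγ hmup' hmup hle with ⟨t, ht₃, ht, hd⟩ | hmem
    · exact Or.inr (Or.inl ⟨hv' (H'.mem_smul hiso ht₃ ht hd),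
        H'.dist_lt_of_near hwη le_rfl hη ht₃ ht hd⟩)
    · exact Or.inr (Or.inr ((hB' _ (Or.inl hmem)).trans (le_max_left _ _)))
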